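/- Let A : ℝ³ → Fin 3 → Matrix (Fin n) (Fin n) ℝ be a differentiable matrix-valued one-form with components A_a, and ξ : ℝ³ → Fin 3 → ℝ a differentiable vector field with components ξ^a. Define the curvature F_{ab}(x) := ∂_a A_b(x) − ∂_b A_a(x) + ⁅A_a(x), A_b(x)⁆ and the Lie derivative (L_ξ A)_a(x) := Σ_b ξ^b(x)·∂_b A_a(x) + Σ_b A_b(x)·(∂_a ξ^b)(x). Then for all x and a: (L_ξ A)_a(x) = Σ_b ξ^b(x)·F_{ba}(x) + ∂_a( Σ_b ξ^b·A_b )(x) + ⁅A_a(x), Σ_b ξ^b(x)·A_b(x)⁆. (Cartan-type identity: L_ξ A = ι_ξ F + d_A(ι_ξ A); the action of a diffeomorphism on a connection is a flatness transformation plus a gauge transformation with field-dependent parameters.) -/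

import Mathlib

attribute [local instance] Matrix.normedAddCommGroup Matrix.normedSpace

/-- The `a`-th partial derivative: the Fréchet derivative applied to the `a`-th standard
coordinate direction of `ℝ³`. -/
noncomputable def pd {M : Type*} [NormedAddCommGroup M] [NormedSpace ℝ M]
    (a : Fin 3) (f : EuclideanSpace ℝ (Fin 3) → M) (x : EuclideanSpace ℝ (Fin 3)) : M :=
  fderiv ℝ f x (EuclideanSpace.single a 1)

/-- Cartan-type identity `L_ξ A = ι_ξ F + d_A(ι_ξ A)`: for a differentiable
matrix-valued one-form with components `A_a` on ℝ³, curvature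
`F_{ab} = ∂_a A_b − ∂_b A_a + ⁅A_a, A_b⁆`, a differentiable vector field `ξ`, and the Lie
derivative `(L_ξ A)_a = Σ_b ξ^b ∂_b A_a + Σ_b (∂_a ξ^b) A_b`, one has
`(L_ξ A)_a = Σ_b ξ^b F_{ba} + ∂_a(Σ_b ξ^b A_b) + ⁅A_a, Σ_b ξ^b A_b⁆`. -/
theorem stmt_14 {n : ℕ}
    (A : EuclideanSpace ℝ (Fin 3) → Fin 3 → Matrix (Fin n) (Fin n) ℝ)
    (hA : ∀ b : Fin 3, Differentiable ℝ (fun x => A x b))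
    (ξ : EuclideanSpace ℝ (Fin 3) → Fin 3 → ℝ)
    (hξ : ∀ b : Fin 3, Differentiable ℝ (fun x => ξ x b))
    (F : EuclideanSpace ℝ (Fin 3) → Fin 3 → Fin 3 → Matrix (Fin n) (Fin n) ℝ)
    (hF : ∀ x (a b : Fin 3),
      F x a b = pd a (fun y => A y b) x - pd b (fun y => A y a) x + ⁅A x a, A x b⁆)
    (L : EuclideanSpace ℝ (Fin 3) → Fin 3 → Matrix (Fin n) (Fin n) ℝ)
    (hL : ∀ x (a : Fin 3), L x a = ∑ b : Fin 3, ξ x b • pd b (fun y => A y a) x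
        + ∑ b : Fin 3, pd a (fun y => ξ y b) x • A x b)
    (x : EuclideanSpace ℝ (Fin 3)) (a : Fin 3) :
    L x a = ∑ b : Fin 3, ξ x b • F x b a
      + pd a (fun y => ∑ b : Fin 3, ξ y b • A y b) x
      + ⁅A x a, ∑ b : Fin 3, ξ x b • A x b⁆ := by
  have h1 : pd a (fun y => ∑ b : Fin 3, ξ y b • A y b) x
      = ∑ b : Fin 3, (ξ x b • pd a (fun y => A y b) x + pd a (fun y => ξ y b) x • A x b) := by
    have h2 := HasFDerivAt.fun_sum (u := Finset.univ) (fun (b : Fin 3) _ =>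
      ((hξ b) x).hasFDerivAt.smul ((hA b) x).hasFDerivAt)
    unfold pd
    erw [h2.fderiv]
    rw [ContinuousLinearMap.sum_apply]
    rfl
  have h3 : ⁅A x a, ∑ b : Fin 3, ξ x b • A x b⁆ = ∑ b : Fin 3, ξ x b • ⁅A x a, A x b⁆ := by
    simp only [Ring.lie_def, Finset.mul_sum, Finset.sum_mul, smul_sub, Finset.sum_sub_distrib,
      Matrix.mul_smul, Matrix.smul_mul]
  rw [hL, h1, h3, ← Finset.sum_add_distrib, ← Finset.sum_add_distrib, ← Finset.sum_add_distrib]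
  refine Finset.sum_congr rfl fun b _ => ?_
  rw [hF, Ring.lie_def, Ring.lie_def]
  simp only [smul_add, smul_sub]
  abel
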